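/- Let n ≥ 1, λ_0 ∈ ℂ, λ = (λ_1,…,λ_n) ∈ ℂⁿ and μ ∈ ℂ with Re λ_i > 0 for all i and Re(μ − |λ|) > 0. Then for every x ∈ ℂⁿ with |x_i| < 1 for all i, Lauricella's series F_D(λ_0, λ, μ; x) = Σ_{m∈ℕⁿ} [(λ_0)_{|m|} (λ)_m / ((μ)_{|m|} · m!)] x^m converges absolutely and equals [Γ(μ)/(Γ(λ_1)⋯Γ(λ_n)Γ(μ−|λ|))] · ∫_{Δ_n} (∏_{i=1}^n t_i^{λ_i−1}) (1−|t|)^{μ−|λ|−1} (1 − t_1x_1 − ⋯ − t_nx_n)^{−λ_0} dt, the integral being absolutely convergent (on the domain |t_1x_1+⋯+t_nx_n| < 1, so the last factor is a principal power of a base off (−∞,0]). -/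

import Mathlib

open MeasureTheory Complex

noncomputable section

/-- The open simplex `{t ∈ ℝⁿ : tᵢ > 0, t₁ + ⋯ + tₙ < 1}`. -/
def openSimplex (n : ℕ) : Set (Fin n → ℝ) := {t | (∀ i, 0 < t i) ∧ ∑ i, t i < 1}

/-- The Pochhammer symbol `(a)ₖ = a(a+1)⋯(a+k-1)`. -/
def poch (a : ℂ) (k : ℕ) : ℂ := ∏ i ∈ Finset.range k, (a + i)

/-- The function `s ↦ s ^ (a - 1)` on the positive half-line, extended by zero. -/
def posPow (a : ℂ) (s : ℝ) : ℂ := if 0 < s then (s : ℂ) ^ (a - 1) else 0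

lemma measurable_posPow (a : ℂ) : Measurable (posPow a) := by
  unfold posPow
  exact Measurable.ite measurableSet_Ioi (by fun_prop) measurable_const

lemma ofReal_norm_posPow (a : ℂ) (s : ℝ) : ((‖posPow a s‖ : ℝ) : ℂ) = posPow (a.re : ℂ) s := by
  unfold posPow
  split_ifs with hs
  · rw [norm_cpow_eq_rpow_re_of_pos hs, ofReal_cpow hs.le]
    simp
  · simp

lemma posPow_mul_pow (a : ℂ) (k : ℕ) (s : ℝ) :
    posPow a s * (s : ℂ) ^ k = posPow (a + k) s := by
  unfold posPow
  split_ifs with hs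
  · rw [← cpow_natCast, ← cpow_add _ _ (ofReal_ne_zero.2 hs.ne')]
    congr 1
    ring
  · simp

lemma posPow_mul_posPow_sub (a b : ℂ) (c : ℝ) :
    (fun s : ℝ => posPow a s * posPow b (c - s)) =
      (Set.Ioo 0 c).indicator (fun s : ℝ => (s : ℂ) ^ (a - 1) * ((c : ℂ) - s) ^ (b - 1)) := by
  ext s
  by_cases hs : s ∈ Set.Ioo 0 c
  · rw [Set.indicator_of_mem hs, posPow, posPow, if_pos hs.1, if_pos (sub_pos.2 hs.2)]
    push_cast
    rfl
  · rw [Set.indicator_of_notMem hs, posPow, posPow]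
    rcases not_and_or.1 hs with h | h
    · rw [if_neg h, zero_mul]
    · rw [if_neg (c := 0 < c - s) (by simpa using h), mul_zero]

lemma integrable_posPow_mul_posPow_sub {a b : ℂ} (ha : 0 < a.re) (hb : 0 < b.re) (c : ℝ) :
    Integrable (fun s : ℝ => posPow a s * posPow b (c - s)) := by
  rcases le_or_gt c 0 with hc | hc
  · rw [posPow_mul_posPow_sub, Set.Ioo_eq_empty (not_lt.2 hc), Set.indicator_empty]
    exact integrable_zero _ _ _
  · have h1 : IntegrableOn (fun x : ℝ => (x : ℂ) ^ (a - 1) * (1 - (x : ℂ)) ^ (b - 1))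
        (Set.Ioo 0 1) := by
      have := betaIntegral_convergent ha hb
      rwa [intervalIntegrable_iff_integrableOn_Ioo_of_le zero_le_one] at this
    have h2 : Integrable (fun s : ℝ => posPow a s * posPow b (1 - s)) := by
      rw [posPow_mul_posPow_sub, integrable_indicator_iff measurableSet_Ioo]
      simpa using h1
    have h3 := (h2.comp_mul_left' (inv_ne_zero hc.ne')).const_mul
      ((c : ℂ) ^ (a - 1) * (c : ℂ) ^ (b - 1))
    refine h3.congr (Filter.Eventually.of_forall fun s => ?_)
    have key : ∀ (d : ℂ) (x : ℝ), (c : ℂ) ^ (d - 1) * posPow d (c⁻¹ * x) = posPow d x := by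
      intro d x
      unfold posPow
      by_cases hx : 0 < x
      · have : 0 < c⁻¹ * x := by positivity
        rw [if_pos hx, if_pos this, ← mul_cpow_ofReal_nonneg hc.le this.le]
        congr 1
        rw [← ofReal_mul, mul_inv_cancel_left₀ hc.ne']
      · have : ¬ 0 < c⁻¹ * x := by
          rw [not_lt] at hx ⊢
          exact mul_nonpos_of_nonneg_of_nonpos (by positivity) hx
        rw [if_neg hx, if_neg this, mul_zero]
    have e : (1 : ℝ) - c⁻¹ * s = c⁻¹ * (c - s) := by
      field_simp
    simp only []
    rw [e, mul_mul_mul_comm, key, key]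

lemma integral_posPow_mul_posPow_sub {a b : ℂ} (ha : 0 < a.re) (hb : 0 < b.re) (c : ℝ) :
    ∫ s : ℝ, posPow a s * posPow b (c - s) =
      Gamma a * Gamma b / Gamma (a + b) * posPow (a + b) c := by
  rw [posPow_mul_posPow_sub, integral_indicator measurableSet_Ioo]
  rcases le_or_gt c 0 with hc | hc
  · rw [Set.Ioo_eq_empty (not_lt.2 hc), posPow, if_neg (not_lt.2 hc)]
    simp
  · rw [← integral_Ioc_eq_integral_Ioo, ← intervalIntegral.integral_of_le hc.le,
      betaIntegral_scaled _ _ hc, betaIntegral_eq_Gamma_mul_div _ _ ha hb, posPow, if_pos hc,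
      mul_comm]

/-- The Dirichlet density `∏ tᵢ ^ (aᵢ - 1) * (c - |t|) ^ (b - 1)` on the open simplex of size `c`,
extended by zero. -/
def dirichletDensity {n : ℕ} (a : Fin n → ℂ) (b : ℂ) (c : ℝ) (t : Fin n → ℝ) : ℂ :=
  (∏ i, posPow (a i) (t i)) * posPow b (c - ∑ i, t i)

lemma measurable_dirichletDensity {n : ℕ} (a : Fin n → ℂ) (b : ℂ) (c : ℝ) :
    Measurable (dirichletDensity a b c) := by
  unfold dirichletDensity
  refine Measurable.mul ?_ ?_
  · exact Finset.measurable_prod _ fun i _ => (measurable_posPow _).comp (measurable_pi_apply i)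
  · exact (measurable_posPow _).comp (by fun_prop)

lemma ofReal_norm_dirichletDensity {n : ℕ} (a : Fin n → ℂ) (b : ℂ) (c : ℝ) (t : Fin n → ℝ) :
    ((‖dirichletDensity a b c t‖ : ℝ) : ℂ) =
      dirichletDensity (fun i => ((a i).re : ℂ)) (b.re : ℂ) c t := by
  simp [dirichletDensity, ofReal_norm_posPow, norm_prod]

lemma dirichletDensity_cons {n : ℕ} (a : Fin (n + 1) → ℂ) (b : ℂ) (c s : ℝ) (u : Fin n → ℝ) :
    dirichletDensity a b c (Fin.cons s u) =
      posPow (a 0) s * dirichletDensity (fun i => a i.succ) b (c - s) u := by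
  simp [dirichletDensity, Fin.prod_univ_succ, Fin.sum_univ_succ, mul_assoc, sub_sub]

lemma re_sum_add_pos {n : ℕ} {a : Fin n → ℂ} {b : ℂ} (ha : ∀ i, 0 < (a i).re) (hb : 0 < b.re) :
    0 < ((∑ i, a i) + b).re := by
  rw [add_re, re_sum]
  exact add_pos_of_nonneg_of_pos (Finset.sum_nonneg fun i _ => (ha i).le) hb

/-- **Dirichlet's integral** over the simplex. -/
theorem dirichlet_integral {n : ℕ} (a : Fin n → ℂ) (b : ℂ) (ha : ∀ i, 0 < (a i).re)
    (hb : 0 < b.re) (c : ℝ) :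
    Integrable (dirichletDensity a b c) ∧
      ∫ t, dirichletDensity a b c t =
        (∏ i, Gamma (a i)) * Gamma b / Gamma ((∑ i, a i) + b) * posPow ((∑ i, a i) + b) c := by
  induction n generalizing b c with
  | zero =>
    have hG := Gamma_ne_zero_of_re_pos hb
    have : dirichletDensity a b c = fun _ => posPow b c := by
      ext t
      simp [dirichletDensity]
    rw [this]
    refine ⟨?_, ?_⟩
    · rw [integrable_const_iff]
      right
      exact ⟨by simp [volume_pi]⟩
    · simp [hG, measureReal_def, volume_pi]
  | succ n ih =>
    set aTail : Fin n → ℂ := fun i => a i.succ with hTail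
    have hpos : 0 < ((∑ i, aTail i) + b).re := re_sum_add_pos (fun i => ha i.succ) hb
    let e := (MeasurableEquiv.piFinSuccAbove (fun _ : Fin (n + 1) => ℝ) 0).symm
    have he : MeasurePreserving e := (volume_preserving_piFinSuccAbove (fun _ => ℝ) 0).symm
    have hF : ∀ p : ℝ × (Fin n → ℝ), dirichletDensity a b c (e p) =
        posPow (a 0) p.1 * dirichletDensity aTail b (c - p.1) p.2 := by
      intro p
      rw [← dirichletDensity_cons]
      simp [e, MeasurableEquiv.piFinSuccAbove_symm_apply, Fin.insertNthEquiv, Fin.insertNth_zero']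
    have hmeas : AEStronglyMeasurable (fun p => dirichletDensity a b c (e p))
        ((volume : Measure ℝ).prod (volume : Measure (Fin n → ℝ))) :=
      ((measurable_dirichletDensity a b c).comp e.measurable).aestronglyMeasurable
    have hnorm : ∀ s : ℝ, ((∫ u, ‖dirichletDensity a b c (e (s, u))‖ : ℝ) : ℂ) =
        ((∏ i, Gamma ((aTail i).re : ℂ)) * Gamma (b.re : ℂ) /
          Gamma ((∑ i, ((aTail i).re : ℂ)) + (b.re : ℂ))) *
        (posPow ((a 0).re : ℂ) s * posPow ((∑ i, ((aTail i).re : ℂ)) + (b.re : ℂ)) (c - s)) := by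
      intro s
      rw [← integral_complex_ofReal]
      simp_rw [hF, norm_mul, ofReal_mul, ofReal_norm_posPow, ofReal_norm_dirichletDensity]
      rw [integral_const_mul, (ih _ _ (fun i => by simpa using ha i.succ) (by simpa using hb) _).2]
      ring
    have hint : Integrable (fun p => dirichletDensity a b c (e p))
        ((volume : Measure ℝ).prod (volume : Measure (Fin n → ℝ))) := by
      rw [integrable_prod_iff hmeas]
      refine ⟨Filter.Eventually.of_forall fun s => ?_, ?_⟩
      · simp_rw [hF]
        exact (ih aTail b (fun i => ha i.succ) hb (c - s)).1.const_mul _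
      · have h : Integrable fun s : ℝ =>
            ((∫ u, ‖dirichletDensity a b c (e (s, u))‖ : ℝ) : ℂ) := ?_
        · exact h.re
        simp only [hnorm]
        refine Integrable.const_mul (integrable_posPow_mul_posPow_sub ?_ ?_ c) _
        · simpa using ha 0
        · refine re_sum_add_pos (fun i => ?_) ?_
          · simpa using ha i.succ
          · simpa using hb
    refine ⟨(he.integrable_comp_emb e.measurableEmbedding).1 hint, ?_⟩
    rw [← he.integral_comp e.measurableEmbedding, Measure.volume_eq_prod, integral_prod _ hint]
    simp_rw [hF, integral_const_mul, (ih aTail b (fun i => ha i.succ) hb _).2]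
    have : ∀ s, posPow (a 0) s * ((∏ i, Gamma (aTail i)) * Gamma b / Gamma ((∑ i, aTail i) + b) *
        posPow ((∑ i, aTail i) + b) (c - s)) =
        ((∏ i, Gamma (aTail i)) * Gamma b / Gamma ((∑ i, aTail i) + b)) *
          (posPow (a 0) s * posPow ((∑ i, aTail i) + b) (c - s)) := fun s => by ring
    simp_rw [this]
    rw [integral_const_mul, integral_posPow_mul_posPow_sub (ha 0) hpos, Fin.sum_univ_succ,
      Fin.prod_univ_succ]
    have hG := Gamma_ne_zero_of_re_pos hpos
    rw [add_assoc]
    field_simp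
    simp only [hTail]
    ring

lemma poch_succ (a : ℂ) (k : ℕ) : poch a (k + 1) = poch a k * (a + k) := by
  simp [poch, Finset.prod_range_succ]

lemma poch_eq_eval_ascPochhammer (a : ℂ) (k : ℕ) : poch a k = (ascPochhammer ℂ k).eval a := by
  induction k with
  | zero => simp [poch]
  | succ k ih => rw [poch_succ, ascPochhammer_succ_eval, ih]

lemma Gamma_add_nat_eq_poch_mul {a : ℂ} (ha : 0 < a.re) (k : ℕ) :
    Gamma (a + k) = poch a k * Gamma a := by
  induction k with
  | zero => simp [poch]
  | succ k ih =>
    have h : a + k ≠ 0 := fun h => by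
      have := congrArg re h
      simp only [add_re, natCast_re, zero_re] at this
      have := k.cast_nonneg (α := ℝ)
      linarith
    rw [poch_succ, Nat.cast_succ, ← add_assoc, Gamma_add_one _ h, ih]
    ring

lemma ringChoose_eq_poch_div (a : ℂ) (k : ℕ) :
    Ring.choose (a + k - 1) k = poch a k / (k.factorial : ℂ) := by
  have h := Ring.factorial_nsmul_multichoose_eq_ascPochhammer a k
  have hk : (k.factorial : ℂ) ≠ 0 := Nat.cast_ne_zero.2 k.factorial_ne_zero
  rw [eq_div_iff hk, poch_eq_eval_ascPochhammer, ← Polynomial.ascPochhammer_smeval_eq_eval, ← h,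
    Ring.choose, nsmul_eq_mul, mul_comm]
  congr 2
  ring

lemma hasSum_one_sub_cpow (a : ℂ) {z : ℂ} (hz : ‖z‖ < 1) :
    HasSum (fun k : ℕ => poch a k / (k.factorial : ℂ) * z ^ k) ((1 - z) ^ (-a)) := by
  have h := (one_div_one_sub_cpow_hasFPowerSeriesOnBall_zero a).hasSum (y := z)
    (by simpa [← ofReal_norm] using hz)
  simpa [ringChoose_eq_poch_div, cpow_neg, FormalMultilinearSeries.ofScalars_apply_eq,
    mul_comm] using h

lemma summable_norm_poch_div_mul_pow (a : ℂ) {r : ℝ} (hr0 : 0 ≤ r) (hr : r < 1) :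
    Summable (fun k : ℕ => ‖poch a k‖ / (k.factorial : ℝ) * r ^ k) := by
  have hrball : (r : ℂ) ∈ Metric.eball (0 : ℂ) 1 := by
    simpa [abs_of_nonneg hr0, ← ofReal_norm] using hr
  have h := FormalMultilinearSeries.summable_norm_apply _ (Metric.eball_subset_eball
    (one_div_one_sub_cpow_hasFPowerSeriesOnBall_zero a).r_le hrball)
  simpa [ringChoose_eq_poch_div, FormalMultilinearSeries.ofScalars_apply_eq,
    abs_of_nonneg hr0, mul_comm] using h

lemma sum_piAntidiag_prod_pow_div_factorial {K : Type*} [Field K] [CharZero K] {n : ℕ}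
    (y : Fin n → K) (k : ℕ) :
    ∑ m ∈ Finset.piAntidiag Finset.univ k, (∏ i, y i ^ m i) / ∏ i, ((m i).factorial : K) =
      (∑ i, y i) ^ k / (k.factorial : K) := by
  rw [Finset.sum_pow_eq_sum_piAntidiag, Finset.sum_div]
  refine Finset.sum_congr rfl fun m hm => ?_
  have h := Nat.multinomial_spec Finset.univ m
  rw [(Finset.mem_piAntidiag.1 hm).1] at h
  have hk : (k.factorial : K) ≠ 0 := Nat.cast_ne_zero.2 k.factorial_ne_zero
  have hm : (∏ i, ((m i).factorial : K)) ≠ 0 :=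
    Finset.prod_ne_zero_iff.2 fun i _ => Nat.cast_ne_zero.2 (m i).factorial_ne_zero
  rw [div_eq_div_iff hm hk, ← h]
  push_cast
  ring

lemma hasSum_fiber_sum {E : Type*} [AddCommMonoid E] [TopologicalSpace E] {n : ℕ}
    (f : (Fin n → ℕ) → E) (k : ℕ) :
    HasSum (fun m : {m : Fin n → ℕ // ∑ i, m i = k} => f m)
      (∑ m ∈ Finset.piAntidiag Finset.univ k, f m) := by
  have h : HasSum ({m : Fin n → ℕ | ∑ i, m i = k}.indicator f)
      (∑ m ∈ Finset.piAntidiag Finset.univ k, {m : Fin n → ℕ | ∑ i, m i = k}.indicator f m) := by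
    refine hasSum_sum_of_ne_finset_zero fun m hm => Set.indicator_of_notMem (fun h => hm ?_) _
    simpa using h
  rw [Finset.sum_congr rfl fun m hm =>
    Set.indicator_of_mem (s := {m : Fin n → ℕ | ∑ i, m i = k}) (by simpa using hm) f] at h
  exact hasSum_subtype_iff_indicator.2 h

/-- Multinomial regrouping of a nonnegative series by total degree. -/
lemma hasSum_multinomial_of_nonneg {n : ℕ} {c : ℕ → ℝ} (hc : ∀ k, 0 ≤ c k) {y : Fin n → ℝ}
    (hy : ∀ i, 0 ≤ y i) (hs : Summable fun k => c k / (k.factorial : ℝ) * (∑ i, y i) ^ k) :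
    HasSum (fun m : Fin n → ℕ => c (∑ i, m i) * ((∏ i, y i ^ m i) / ∏ i, ((m i).factorial : ℝ)))
      (∑' k, c k / (k.factorial : ℝ) * (∑ i, y i) ^ k) := by
  set f : (Fin n → ℕ) → ℝ :=
    fun m => c (∑ i, m i) * ((∏ i, y i ^ m i) / ∏ i, ((m i).factorial : ℝ)) with hf
  have hf0 : ∀ m, 0 ≤ f m := fun m => mul_nonneg (hc _) <| div_nonneg
    (Finset.prod_nonneg fun i _ => pow_nonneg (hy i) _) (by positivity)
  have hfib : ∀ k, HasSum (fun m : {m : Fin n → ℕ // ∑ i, m i = k} => f m)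
      (c k / (k.factorial : ℝ) * (∑ i, y i) ^ k) := by
    intro k
    convert hasSum_fiber_sum f k using 1
    rw [div_mul_eq_mul_div, mul_div_assoc, ← sum_piAntidiag_prod_pow_div_factorial,
      Finset.mul_sum]
    refine Finset.sum_congr rfl fun m hm => ?_
    simp only [hf, (Finset.mem_piAntidiag.1 hm).1]
  let e := Equiv.sigmaFiberEquiv (fun m : Fin n → ℕ => ∑ i, m i)
  rw [← e.hasSum_iff]
  have hsum : Summable (f ∘ e) := by
    refine (summable_sigma_of_nonneg fun p => hf0 _).2 ⟨fun k => (hfib k).summable, ?_⟩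
    refine hs.congr fun k => ?_
    exact (hfib k).tsum_eq.symm
  have h := hsum.hasSum.sigma hfib
  rw [h.tsum_eq]
  exact hsum.hasSum

lemma hasSum_multinomial {n : ℕ} {c : ℕ → ℂ} {y : Fin n → ℂ} {S : ℂ}
    (hs : Summable fun k => ‖c k‖ / (k.factorial : ℝ) * (∑ i, ‖y i‖) ^ k)
    (hS : HasSum (fun k => c k / (k.factorial : ℂ) * (∑ i, y i) ^ k) S) :
    HasSum (fun m : Fin n → ℕ => c (∑ i, m i) * ((∏ i, y i ^ m i) / ∏ i, ((m i).factorial : ℂ)))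
      S := by
  set f : (Fin n → ℕ) → ℂ :=
    fun m => c (∑ i, m i) * ((∏ i, y i ^ m i) / ∏ i, ((m i).factorial : ℂ)) with hf
  have hsumf : Summable f := by
    refine Summable.of_norm ?_
    refine (hasSum_multinomial_of_nonneg (fun k => norm_nonneg (c k))
      (fun i => norm_nonneg (y i)) hs).summable.congr fun m => ?_
    simp [hf]
  have hfib : ∀ k, HasSum (fun m : {m : Fin n → ℕ // ∑ i, m i = k} => f m)
      (c k / (k.factorial : ℂ) * (∑ i, y i) ^ k) := by
    intro k
    convert hasSum_fiber_sum f k using 1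
    rw [div_mul_eq_mul_div, mul_div_assoc, ← sum_piAntidiag_prod_pow_div_factorial,
      Finset.mul_sum]
    refine Finset.sum_congr rfl fun m hm => ?_
    simp only [hf, (Finset.mem_piAntidiag.1 hm).1]
  let e := Equiv.sigmaFiberEquiv (fun m : Fin n → ℕ => ∑ i, m i)
  have h := (e.hasSum_iff.2 hsumf.hasSum).sigma hfib
  rw [hS.unique h]
  exact hsumf.hasSum

lemma measurableSet_openSimplex (n : ℕ) : MeasurableSet (openSimplex n) := by
  refine MeasurableSet.inter ?_ ?_
  · exact MeasurableSet.univ_pi' fun _ => measurableSet_Ioi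
  · exact measurableSet_lt (Finset.measurable_sum _ fun i _ => measurable_pi_apply i)
      measurable_const

lemma dirichletDensity_one_eq_indicator {n : ℕ} (a : Fin n → ℂ) (b : ℂ) :
    dirichletDensity a b 1 = (openSimplex n).indicator (fun t =>
      (∏ i, (t i : ℂ) ^ (a i - 1)) * ((1 - ∑ i, t i : ℝ) : ℂ) ^ (b - 1)) := by
  ext t
  by_cases ht : t ∈ openSimplex n
  · rw [Set.indicator_of_mem ht, dirichletDensity, posPow, if_pos (sub_pos.2 ht.2)]
    congr 1
    exact Finset.prod_congr rfl fun i _ => if_pos (ht.1 i)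
  · rw [Set.indicator_of_notMem ht, dirichletDensity]
    rcases not_and_or.1 ht with h | h
    · obtain ⟨i, hi⟩ := not_forall.1 h
      rw [Finset.prod_eq_zero (Finset.mem_univ i) (if_neg hi), zero_mul]
    · rw [posPow, if_neg (by simpa using h), mul_zero]

lemma dirichletDensity_mul_prod_pow {n : ℕ} (a : Fin n → ℂ) (b : ℂ) (c : ℝ) (m : Fin n → ℕ)
    (t : Fin n → ℝ) :
    dirichletDensity a b c t * ∏ i, (t i : ℂ) ^ m i =
      dirichletDensity (fun i => a i + m i) b c t := by
  simp only [dirichletDensity, ← posPow_mul_pow, Finset.prod_mul_distrib]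
  ring

lemma sum_norm_mul_le_of_mem_openSimplex {n : ℕ} (x : Fin n → ℂ) {t : Fin n → ℝ}
    (ht : t ∈ openSimplex n) : ∑ i, ‖(t i : ℂ) * x i‖ ≤ ‖x‖ := by
  calc ∑ i, ‖(t i : ℂ) * x i‖ ≤ ∑ i, t i * ‖x‖ := by
        refine Finset.sum_le_sum fun i _ => ?_
        rw [norm_mul, norm_real, Real.norm_of_nonneg (ht.1 i).le]
        exact mul_le_mul_of_nonneg_left (norm_le_pi_norm x i) (ht.1 i).le
    _ = (∑ i, t i) * ‖x‖ := by rw [Finset.sum_mul]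
    _ ≤ ‖x‖ := mul_le_of_le_one_left (norm_nonneg x) ht.2.le

/-- The general term of the multinomial expansion of `(1 - ∑ tᵢ xᵢ) ^ (-a)`. -/
def multinomialTerm {n : ℕ} (a : ℂ) (x : Fin n → ℂ) (m : Fin n → ℕ) (t : Fin n → ℝ) : ℂ :=
  poch a (∑ i, m i) *
    ((∏ i, ((t i : ℂ) * x i) ^ m i) / ∏ i, (Nat.factorial (m i) : ℂ))

section expansion

variable {n : ℕ} (a : ℂ) {x : Fin n → ℂ} {t : Fin n → ℝ}

lemma summable_norm_poch_sum_norm (hx : ‖x‖ < 1) (ht : t ∈ openSimplex n) :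
    Summable fun k : ℕ => ‖poch a k‖ / (k.factorial : ℝ) * (∑ i, ‖(t i : ℂ) * x i‖) ^ k :=
  summable_norm_poch_div_mul_pow a (Finset.sum_nonneg fun _ _ => norm_nonneg _)
    ((sum_norm_mul_le_of_mem_openSimplex x ht).trans_lt hx)

lemma hasSum_multinomialTerm (hx : ‖x‖ < 1) (ht : t ∈ openSimplex n) :
    HasSum (fun m => multinomialTerm a x m t) ((1 - ∑ i, (t i : ℂ) * x i) ^ (-a)) :=
  hasSum_multinomial (summable_norm_poch_sum_norm a hx ht) <| hasSum_one_sub_cpow a <|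
    (norm_sum_le _ _).trans_lt ((sum_norm_mul_le_of_mem_openSimplex x ht).trans_lt hx)

lemma hasSum_norm_multinomialTerm (hx : ‖x‖ < 1) (ht : t ∈ openSimplex n) :
    HasSum (fun m => ‖multinomialTerm a x m t‖)
      (∑' k : ℕ, ‖poch a k‖ / (k.factorial : ℝ) * (∑ i, ‖(t i : ℂ) * x i‖) ^ k) := by
  convert hasSum_multinomial_of_nonneg (fun k => norm_nonneg (poch a k))
    (fun i => norm_nonneg ((t i : ℂ) * x i)) (summable_norm_poch_sum_norm a hx ht) using 2 with m
  simp [multinomialTerm, norm_prod]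

lemma tsum_norm_multinomialTerm_le (hx : ‖x‖ < 1) (ht : t ∈ openSimplex n) :
    ∑' m, ‖multinomialTerm a x m t‖ ≤
      ∑' k : ℕ, ‖poch a k‖ / (k.factorial : ℝ) * ‖x‖ ^ k := by
  rw [(hasSum_norm_multinomialTerm a hx ht).tsum_eq]
  refine Summable.tsum_le_tsum (fun k => ?_) (summable_norm_poch_sum_norm a hx ht)
    (summable_norm_poch_div_mul_pow a (norm_nonneg x) hx)
  have := sum_norm_mul_le_of_mem_openSimplex x ht
  gcongr

end expansion

lemma dirichletDensity_mul_multinomialTerm {n : ℕ} (a : ℂ) (x : Fin n → ℂ) (lam : Fin n → ℂ)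
    (b : ℂ) (m : Fin n → ℕ) (t : Fin n → ℝ) :
    dirichletDensity lam b 1 t * multinomialTerm a x m t =
      poch a (∑ i, m i) * (∏ i, x i ^ m i) / (∏ i, (Nat.factorial (m i) : ℂ)) *
        dirichletDensity (fun i => lam i + m i) b 1 t := by
  rw [← dirichletDensity_mul_prod_pow, multinomialTerm]
  simp only [mul_pow, Finset.prod_mul_distrib]
  ring

section interchange

variable {n : ℕ} (lam0 : ℂ) {lam : Fin n → ℂ} {b : ℂ} {x : Fin n → ℂ}

lemma integrable_dirichletDensity_mul_multinomialTerm (hlam : ∀ i, 0 < (lam i).re)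
    (hb : 0 < b.re) (x : Fin n → ℂ) (m : Fin n → ℕ) :
    Integrable (fun t => dirichletDensity lam b 1 t * multinomialTerm lam0 x m t) := by
  simp_rw [dirichletDensity_mul_multinomialTerm]
  refine (dirichlet_integral _ b (fun i => ?_) hb 1).1.const_mul _
  rw [add_re, natCast_re]
  exact add_pos_of_pos_of_nonneg (hlam i) (Nat.cast_nonneg _)

lemma integral_dirichletDensity_mul_multinomialTerm (hlam : ∀ i, 0 < (lam i).re)
    (hb : 0 < b.re) (x : Fin n → ℂ) (m : Fin n → ℕ) :
    ∫ t, dirichletDensity lam b 1 t * multinomialTerm lam0 x m t =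
      (∏ i, Gamma (lam i)) * Gamma b / Gamma ((∑ i, lam i) + b) *
        (poch lam0 (∑ i, m i) * (∏ i, poch (lam i) (m i)) /
          (poch ((∑ i, lam i) + b) (∑ i, m i) * ∏ i, (Nat.factorial (m i) : ℂ)) *
          ∏ i, x i ^ m i) := by
  have hm : ∀ i, 0 < (lam i + m i).re := fun i => by
    rw [add_re, natCast_re]
    exact add_pos_of_pos_of_nonneg (hlam i) (Nat.cast_nonneg _)
  have hsum : ∑ i, (lam i + m i) + b = (∑ i, lam i) + b + ((∑ i, m i : ℕ) : ℂ) := by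
    rw [Finset.sum_add_distrib]
    push_cast
    ring
  simp_rw [dirichletDensity_mul_multinomialTerm]
  rw [integral_const_mul, (dirichlet_integral _ b hm hb 1).2, hsum,
    Gamma_add_nat_eq_poch_mul (re_sum_add_pos hlam hb),
    Finset.prod_congr rfl fun i _ => Gamma_add_nat_eq_poch_mul (hlam i) (m i),
    Finset.prod_mul_distrib, posPow, if_pos one_pos, ofReal_one, one_cpow]
  simp only [div_eq_mul_inv, mul_inv]
  ring

lemma summable_integral_norm_dirichletDensity_mul_multinomialTerm (hlam : ∀ i, 0 < (lam i).re)
    (hb : 0 < b.re) (hx : ‖x‖ < 1) :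
    Summable fun m => ∫ t, ‖dirichletDensity lam b 1 t * multinomialTerm lam0 x m t‖ := by
  have hD := (dirichlet_integral lam b hlam hb 1).1
  have hT := integrable_dirichletDensity_mul_multinomialTerm lam0 hlam hb x
  refine summable_of_sum_le (c := ∫ t, ‖dirichletDensity lam b 1 t‖ *
    ∑' k : ℕ, ‖poch lam0 k‖ / (k.factorial : ℝ) * ‖x‖ ^ k)
    (fun m => integral_nonneg fun t => norm_nonneg _) fun u => ?_
  rw [← integral_finsetSum _ fun m _ => (hT m).norm]
  refine integral_mono (integrable_finsetSum _ fun m _ => (hT m).norm) (hD.norm.mul_const _)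
    fun t => ?_
  simp only [norm_mul, ← Finset.mul_sum]
  by_cases ht : t ∈ openSimplex n
  · refine mul_le_mul_of_nonneg_left ?_ (norm_nonneg _)
    exact ((hasSum_norm_multinomialTerm lam0 hx ht).summable.sum_le_tsum u
      fun m _ => norm_nonneg _).trans (tsum_norm_multinomialTerm_le lam0 hx ht)
  · simp [dirichletDensity_one_eq_indicator, ht]

lemma dirichletDensity_mul_tsum_multinomialTerm (lam : Fin n → ℂ) (b : ℂ) (hx : ‖x‖ < 1)
    (t : Fin n → ℝ) :
    ∑' m, dirichletDensity lam b 1 t * multinomialTerm lam0 x m t =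
      dirichletDensity lam b 1 t * (1 - ∑ i, (t i : ℂ) * x i) ^ (-lam0) := by
  by_cases ht : t ∈ openSimplex n
  · rw [tsum_mul_left, (hasSum_multinomialTerm lam0 hx ht).tsum_eq]
  · simp [dirichletDensity_one_eq_indicator, ht]

lemma integrable_dirichletDensity_mul_cpow (hlam : ∀ i, 0 < (lam i).re)
    (hb : 0 < b.re) (hx : ‖x‖ < 1) :
    Integrable fun t => dirichletDensity lam b 1 t * (1 - ∑ i, (t i : ℂ) * x i) ^ (-lam0) := by
  refine ((dirichlet_integral lam b hlam hb 1).1.norm.mul_const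
    (∑' k : ℕ, ‖poch lam0 k‖ / (k.factorial : ℝ) * ‖x‖ ^ k)).mono' ?_
    (Filter.Eventually.of_forall fun t => ?_)
  · exact ((measurable_dirichletDensity lam b 1).mul (by fun_prop)).aestronglyMeasurable
  · rw [norm_mul]
    by_cases ht : t ∈ openSimplex n
    · refine mul_le_mul_of_nonneg_left ?_ (norm_nonneg _)
      rw [← (hasSum_multinomialTerm lam0 hx ht).tsum_eq]
      exact (norm_tsum_le_tsum_norm (hasSum_norm_multinomialTerm lam0 hx ht).summable).trans
        (tsum_norm_multinomialTerm_le lam0 hx ht)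
    · simp [dirichletDensity_one_eq_indicator, ht]

end interchange

theorem stmt6 (n : ℕ) (hn : 1 ≤ n) (lam0 : ℂ) (lam : Fin n → ℂ) (μ : ℂ)
    (hlam : ∀ i, 0 < (lam i).re) (hμ : 0 < (μ - ∑ i, lam i).re)
    (x : Fin n → ℂ) (hx : ∀ i, ‖x i‖ < 1) :
    Summable (fun m : Fin n → ℕ =>
      ‖poch lam0 (∑ i, m i) * (∏ i, poch (lam i) (m i)) /
          (poch μ (∑ i, m i) * ∏ i, (Nat.factorial (m i) : ℂ)) *
          ∏ i, x i ^ m i‖) ∧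
    IntegrableOn
      (fun t : Fin n → ℝ =>
        (∏ i, (t i : ℂ) ^ (lam i - 1)) *
          ((1 - ∑ i, t i : ℝ) : ℂ) ^ (μ - (∑ i, lam i) - 1) *
          (1 - ∑ i, (t i : ℂ) * x i) ^ (-lam0))
      (openSimplex n) ∧
    (∑' m : Fin n → ℕ,
        poch lam0 (∑ i, m i) * (∏ i, poch (lam i) (m i)) /
          (poch μ (∑ i, m i) * ∏ i, (Nat.factorial (m i) : ℂ)) *
          ∏ i, x i ^ m i)
      = Complex.Gamma μ /
          ((∏ i, Complex.Gamma (lam i)) * Complex.Gamma (μ - ∑ i, lam i)) *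
          ∫ t in openSimplex n,
            (∏ i, (t i : ℂ) ^ (lam i - 1)) *
              ((1 - ∑ i, t i : ℝ) : ℂ) ^ (μ - (∑ i, lam i) - 1) *
              (1 - ∑ i, (t i : ℂ) * x i) ^ (-lam0) := by
  have hxn : ‖x‖ < 1 := (pi_norm_lt_iff one_pos).2 hx
  set b := μ - ∑ i, lam i with hb
  have hμb : (∑ i, lam i) + b = μ := by rw [hb]; ring
  have hμ0 : 0 < μ.re := hμb ▸ re_sum_add_pos hlam hμ
  have hC : (∏ i, Gamma (lam i)) * Gamma b / Gamma μ ≠ 0 :=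
    div_ne_zero (mul_ne_zero (Finset.prod_ne_zero_iff.2 fun i _ =>
      Gamma_ne_zero_of_re_pos (hlam i)) (Gamma_ne_zero_of_re_pos hμ))
      (Gamma_ne_zero_of_re_pos hμ0)
  have hind : (fun t => dirichletDensity lam b 1 t * (1 - ∑ i, (t i : ℂ) * x i) ^ (-lam0)) =
      (openSimplex n).indicator fun t => (∏ i, (t i : ℂ) ^ (lam i - 1)) *
        ((1 - ∑ i, t i : ℝ) : ℂ) ^ (b - 1) * (1 - ∑ i, (t i : ℂ) * x i) ^ (-lam0) := by
    ext t
    by_cases ht : t ∈ openSimplex n <;> simp [dirichletDensity_one_eq_indicator, ht]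
  have hsummable := summable_integral_norm_dirichletDensity_mul_multinomialTerm lam0 hlam hμ hxn
  have hterm := integral_dirichletDensity_mul_multinomialTerm lam0 hlam hμ x
  rw [hμb] at hterm
  refine ⟨?_, ?_, ?_⟩
  · have h := (Summable.of_nonneg_of_le (fun m => norm_nonneg _)
      (fun m => norm_integral_le_integral_norm fun t =>
        dirichletDensity lam b 1 t * multinomialTerm lam0 x m t) hsummable).mul_left
      ‖(∏ i, Gamma (lam i)) * Gamma b / Gamma μ‖⁻¹
    refine h.congr fun m => ?_
    rw [hterm, norm_mul _ (_ * _), inv_mul_cancel_left₀ (norm_ne_zero_iff.2 hC)]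
  · rw [← integrable_indicator_iff (measurableSet_openSimplex n), ← hind]
    exact integrable_dirichletDensity_mul_cpow lam0 hlam hμ hxn
  · rw [← integral_indicator (measurableSet_openSimplex n), ← hind]
    simp_rw [← dirichletDensity_mul_tsum_multinomialTerm lam0 lam b hxn]
    rw [← integral_tsum_of_summable_integral_norm
      (integrable_dirichletDensity_mul_multinomialTerm lam0 hlam hμ x) hsummable]
    simp_rw [hterm]
    rw [tsum_mul_left, ← mul_assoc, ← inv_div, inv_mul_cancel₀ hC, one_mul]
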